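/- (Equivalence of two forms of the small-gain condition) Let γ₁₂, γ₂₁ ∈ K ∪ {0} and ρ ∈ K∞, and define the gain operator Γ : ℝ²₊ → ℝ²₊ by Γ(s₁,s₂) := (γ₁₂(s₂), γ₂₁(s₁)). Then the cyclic small-gain condition (id+ρ)∘γ₁₂∘(id+ρ)∘γ₂₁(r) < r for all r > 0 holds if and only if for every s ∈ ℝ²₊ \ {(0,0)} it holds that (id+ρ)(Γ(s)) ≱ s, i.e., there exists j ∈ {1,2} with ((id+ρ)∘Γ(s))_j < s_j, where (id+ρ) is applied componentwise. -/

import Mathlib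

open NNReal

noncomputable section

/-- Comparison class `K`: continuous, strictly increasing functions `ℝ₊ → ℝ₊` vanishing at `0`. -/
def ClassK (γ : ℝ≥0 → ℝ≥0) : Prop :=
  Continuous γ ∧ StrictMono γ ∧ γ 0 = 0

/-- Comparison class `K∞`: unbounded `K`-functions. -/
def ClassKinf (γ : ℝ≥0 → ℝ≥0) : Prop :=
  ClassK γ ∧ ∀ M : ℝ≥0, ∃ r : ℝ≥0, M < γ r

/-- The gain operator `Γ(s₁,s₂) = (γ₁₂(s₂), γ₂₁(s₁))` on `ℝ²₊`. -/
def gainOp (γ₁₂ γ₂₁ : ℝ≥0 → ℝ≥0) (s : ℝ≥0 × ℝ≥0) : ℝ≥0 × ℝ≥0 :=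
  (γ₁₂ s.2, γ₂₁ s.1)

/-- **Equivalence of the two forms of the small-gain condition**: for
`γ₁₂, γ₂₁ ∈ K ∪ {0}` and `ρ ∈ K∞`, the cyclic small-gain condition
`(id+ρ) ∘ γ₁₂ ∘ (id+ρ) ∘ γ₂₁ (r) < r` for all `r > 0` holds iff for every
`s ∈ ℝ²₊ \ {(0,0)}` one has `(id+ρ)(Γ(s)) ≱ s`, i.e., some component of
`(id+ρ)(Γ(s))` is strictly below the corresponding component of `s`. -/
theorem small_gain_conditions_equivalent (γ₁₂ γ₂₁ : ℝ≥0 → ℝ≥0)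
    (h₁₂ : ClassK γ₁₂ ∨ γ₁₂ = fun _ => 0)
    (h₂₁ : ClassK γ₂₁ ∨ γ₂₁ = fun _ => 0)
    (ρ : ℝ≥0 → ℝ≥0) (hρ : ClassKinf ρ) :
    (∀ r : ℝ≥0, 0 < r →
      γ₁₂ (γ₂₁ r + ρ (γ₂₁ r)) + ρ (γ₁₂ (γ₂₁ r + ρ (γ₂₁ r))) < r)
    ↔
    (∀ s : ℝ≥0 × ℝ≥0, s ≠ (0, 0) →
      (gainOp γ₁₂ γ₂₁ s).1 + ρ ((gainOp γ₁₂ γ₂₁ s).1) < s.1 ∨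
      (gainOp γ₁₂ γ₂₁ s).2 + ρ ((gainOp γ₁₂ γ₂₁ s).2) < s.2) := by
  have mono : ∀ γ : ℝ≥0 → ℝ≥0, (ClassK γ ∨ γ = fun _ => 0) → Monotone γ ∧ γ 0 = 0 := by
    rintro γ (h | h)
    · exact ⟨h.2.1.monotone, h.2.2⟩
    · subst h
      exact ⟨monotone_const, rfl⟩
  obtain ⟨m₁, -⟩ := mono _ h₁₂
  obtain ⟨-, z₂⟩ := mono _ h₂₁
  have mρ : Monotone ρ := hρ.1.2.1.monotone
  have zρ : ρ 0 = 0 := hρ.1.2.2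
  constructor
  · rintro h ⟨a, b⟩ hs
    simp only [gainOp]
    by_contra hc
    rw [not_or, not_lt, not_lt] at hc
    obtain ⟨h1, h2⟩ := hc
    rcases eq_or_ne a 0 with ha | ha
    · subst ha
      rw [z₂, zρ, add_zero] at h2
      exact hs (by rw [le_antisymm h2 bot_le])
    · have h3 := m₁ h2
      exact absurd (h a (pos_iff_ne_zero.mpr ha))
        (not_lt.mpr (h1.trans (add_le_add h3 (mρ h3))))
  · intro h r hr
    rcases h (r, γ₂₁ r + ρ (γ₂₁ r)) (fun e => hr.ne' (congrArg Prod.fst e)) with h | h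
    · exact h
    · exact absurd h (lt_irrefl _)
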